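/- Let Q ≥ 1 and λ ≥ 1 be natural numbers and set L = 24·Q^6·λ. Let c : Fin L → ℕ satisfy c j ≤ 15·Q² + 1 for all j and ∑_j c j ≥ 240·Q^7·λ + 2. Then the number of indices j with c j ≥ 4 is at least 6·Q^5·λ. -/

import Mathlib

/-- If every `c j` is at most `m + b`, then the sum of `c` is bounded through the number of indices
at which `c` exceeds `m`. -/
theorem sum_le_card_mul_add_card_filter_mul {ι : Type*} [Fintype ι] (c : ι → ℕ) (m b : ℕ)
    (hc : ∀ j, c j ≤ m + b) :
    ∑ j, c j ≤ Fintype.card ι * m + (Finset.univ.filter fun j => m < c j).card * b := by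
  calc ∑ j, c j ≤ ∑ j, (m + if m < c j then b else 0) := by
        refine Finset.sum_le_sum fun j _ => ?_
        have := hc j
        split_ifs <;> omega
    _ = _ := by
        simp [Finset.sum_add_distrib, ← Finset.sum_filter]

theorem stmt2 (Q lam : ℕ) (hQ : 1 ≤ Q) (hlam : 1 ≤ lam)
    (c : Fin (24 * Q ^ 6 * lam) → ℕ)
    (hc : ∀ j, c j ≤ 15 * Q ^ 2 + 1)
    (hsum : 240 * Q ^ 7 * lam + 2 ≤ ∑ j, c j) :
    6 * Q ^ 5 * lam ≤ (Finset.univ.filter fun j => 4 ≤ c j).card := by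
  by_contra! h
  have hbound := sum_le_card_mul_add_card_filter_mul c 3 (15 * Q ^ 2) fun j => by
    have := hc j
    omega
  rw [Fintype.card_fin] at hbound
  have hcard : (Finset.univ.filter fun j => 3 < c j).card * (15 * Q ^ 2) ≤ 90 * (Q ^ 7 * lam) :=
    calc _ ≤ 6 * Q ^ 5 * lam * (15 * Q ^ 2) := Nat.mul_le_mul_right _ h.le
      _ = _ := by ring
  have hpow : Q ^ 6 * lam ≤ Q ^ 7 * lam :=
    Nat.mul_le_mul_right _ (Nat.pow_le_pow_right hQ (by norm_num))
  linarith [Nat.zero_le (Q ^ 7 * lam)]
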